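/- Let X be a finite set with |X| ≥ 5. There is no consensus method on X (a family of functions φ_X^k : RP(X)^k → RP(X) for all k ≥ 1) that is regular, associatively stable, and such that each φ_X^k is Pareto on rooted triples. -/

import Mathlib

open Set

variable {α : Type*}

/-- `T` is the hierarchy of clusters of a rooted phylogenetic tree on the taxon set `X`:
a family of nonempty subsets of `X` containing `X` itself and all singletons, in which
any two members intersect trivially (`A ∩ B ∈ {∅, A, B}`). -/
def IsHierarchy (X : Set α) (T : Set (Set α)) : Prop :=
  (∀ C ∈ T, C ⊆ X ∧ C.Nonempty) ∧ X ∈ T ∧ (∀ x ∈ X, ({x} : Set α) ∈ T) ∧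
    ∀ A ∈ T, ∀ B ∈ T, A ∩ B = ∅ ∨ A ∩ B = A ∨ A ∩ B = B

/-- `RP X`: rooted phylogenetic trees on `X`, modeled as their hierarchies of clusters. -/
def RP (X : Set α) : Set (Set (Set α)) := {T | IsHierarchy X T}

/-- Restriction `T|_Y` of a tree to a subset `Y` of the taxa:
`T|_Y = {C ∩ Y : C ∈ T, C ∩ Y ≠ ∅}`. -/
def restrictTree (Y : Set α) (T : Set (Set α)) : Set (Set α) :=
  {D | ∃ C ∈ T, D = C ∩ Y ∧ (C ∩ Y).Nonempty}

/-- A tree is binary iff it is maximal in `(RP X, ⊆)`. -/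
def IsBinary (X : Set α) (T : Set (Set α)) : Prop :=
  T ∈ RP X ∧ ∀ T' ∈ RP X, T ⊆ T' → T' = T

/-- `RBP X`: rooted binary phylogenetic trees on `X`. -/
def RBP (X : Set α) : Set (Set (Set α)) := {T | IsBinary X T}

/-- Relabeling a tree along a map `σ`: `σ·T = {σ(C) : C ∈ T}`. -/
def mapTree (σ : α → α) (T : Set (Set α)) : Set (Set α) := (Set.image σ) '' T

/-- A family `φ k : RP(Z)^k → RP(Z)` (`k ≥ 1`) of consensus functions on `Z` is regular
(unanimous, anonymous, neutral), associatively stable, and Pareto on rooted triples. -/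
def IsRegularAssocStablePareto (Z : Set α)
    (φ : (k : ℕ) → (Fin k → Set (Set α)) → Set (Set α)) : Prop :=
  -- each `φ k` maps profiles of trees on `Z` to trees on `Z`
  (∀ k, 1 ≤ k → ∀ Ts : Fin k → Set (Set α), (∀ i, Ts i ∈ RP Z) → φ k Ts ∈ RP Z) ∧
  -- unanimity
  (∀ k, 1 ≤ k → ∀ T ∈ RP Z, φ k (fun _ => T) = T) ∧
  -- anonymity
  (∀ k, 1 ≤ k → ∀ Ts : Fin k → Set (Set α), (∀ i, Ts i ∈ RP Z) →
    ∀ π : Equiv.Perm (Fin k), φ k (Ts ∘ π) = φ k Ts) ∧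
  -- neutrality
  (∀ k, 1 ≤ k → ∀ σ : α → α, Set.BijOn σ Z Z →
    ∀ Ts : Fin k → Set (Set α), (∀ i, Ts i ∈ RP Z) →
      φ k (fun i => mapTree σ (Ts i)) = mapTree σ (φ k Ts)) ∧
  -- associative stability: `φ k (T₁, …, T_k) = φ 2 (φ (k-1) (T₁, …, T_{k-1}), T_k)` for `k ≥ 2`
  (∀ k : ℕ, ∀ Ts : Fin (k + 2) → Set (Set α), (∀ i, Ts i ∈ RP Z) →
    φ (k + 2) Ts = φ 2 ![φ (k + 1) (Fin.init Ts), Ts (Fin.last (k + 1))]) ∧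
  -- Pareto on rooted triples
  (∀ k, 1 ≤ k → ∀ W : Set α, W ⊆ Z → W.ncard = 3 → ∀ T' ∈ RP W,
    ∀ Ts : Fin k → Set (Set α), (∀ i, Ts i ∈ RP Z) →
      (∀ i, T' ⊆ restrictTree W (Ts i)) → T' ⊆ restrictTree W (φ k Ts))


/-! ### Codes for trees on five leaves

A cluster on the leaves `0, …, 4` is a bit mask; a tree is the increasing list of its
nontrivial clusters. -/

namespace Code

/-- Swap the leaves `i` and `j` in a bit mask. -/
def sw (i j c : ℕ) : ℕ :=
  if c.testBit i = c.testBit j then c else c ^^^ (2 ^ i ^^^ 2 ^ j)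

/-- Compatibility of two masks. -/
def cmp (a b : ℕ) : Bool := (a &&& b == 0) || (a &&& b == a) || (a &&& b == b)

/-- The nontrivial masks. -/
def clusters : List ℕ := (List.range 31).filter (fun c => c &&& (c - 1) != 0)

/-- All compatible sublists. -/
def enum : List ℕ → List (List ℕ)
  | [] => [[]]
  | c :: cs => enum cs ++ ((enum cs).filter (fun T => T.all (cmp c))).map (c :: ·)

/-- All trees. -/
def TL : List (List ℕ) := enum clusters

/-- Relabel a tree by a transposition. -/
def act1 (i j : ℕ) (T : List ℕ) : List ℕ := clusters.filter (fun c => T.contains (sw i j c))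

/-- Relabel a tree by a product of transpositions. -/
def act : List (ℕ × ℕ) → List ℕ → List ℕ
  | [], T => T
  | p :: w, T => act w (act1 p.1 p.2 T)

/-- A word only uses leaves below `5`. -/
def okw (w : List (ℕ × ℕ)) : Bool := w.all fun p => p.1.blt 5 && p.2.blt 5

/-- The rooted triple `ab|c` is displayed. -/
def trip (T : List ℕ) (a b c : ℕ) : Bool :=
  T.any fun C => C.testBit a && C.testBit b && !C.testBit c

/-- All (ordered) triples of distinct leaves. -/
def trips : List (ℕ × ℕ × ℕ) :=
  ((List.range 5).flatMap fun a => (List.range 5).flatMap fun b =>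
    (List.range 5).map fun c => (a, b, c)).filter fun t => t.1 < t.2.1 && t.1 != t.2.2 && t.2.1 != t.2.2

/-- A semilattice operation on codes with equivariance and the Pareto property. -/
structure Ax (m : List ℕ → List ℕ → List ℕ) : Prop where
  closed : ∀ S ∈ TL, ∀ T ∈ TL, m S T ∈ TL
  idem : ∀ T ∈ TL, m T T = T
  comm : ∀ S ∈ TL, ∀ T ∈ TL, m S T = m T S
  assoc : ∀ S ∈ TL, ∀ T ∈ TL, ∀ U ∈ TL, m (m S T) U = m S (m T U)
  equi : ∀ i < 5, ∀ j < 5, ∀ S ∈ TL, ∀ T ∈ TL, m (act1 i j S) (act1 i j T) = act1 i j (m S T)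
  actTL : ∀ i < 5, ∀ j < 5, ∀ T ∈ TL, act1 i j T ∈ TL
  pareto : ∀ S ∈ TL, ∀ T ∈ TL, ∀ a < 5, ∀ b < 5, ∀ c < 5, a ≠ b → a ≠ c → b ≠ c →
    trip S a b c = true → trip T a b c = true → trip (m S T) a b c = true

/-- The semilattice order. -/
structure le (m : List ℕ → List ℕ → List ℕ) (S T : List ℕ) : Prop where
  hS : S ∈ TL
  hT : T ∈ TL
  eq : m S T = S

/-- The word `w` maps `(S, T)` to `(S', T')`. -/
def orb2 (w : List (ℕ × ℕ)) (S T S' T' : List ℕ) : Bool :=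
  okw w && act w S == S' && act w T == T'

/-- `S ≠ T` are in the same orbit by the word `w`. -/
def orb1 (w : List (ℕ × ℕ)) (S T : List ℕ) : Bool :=
  S.length == T.length && S != T && okw w && act w S == T &&
    [1, 2, 3, 4, 5].any fun n => (act w)^[n + 1] S == S

/-- Conditions on the product `M` of `S` and `T`. -/
def cand (W : List (List (ℕ × ℕ))) (S T M : List ℕ) : Bool :=
  (trips.all fun t => trip M t.1 t.2.1 t.2.2 || !trip S t.1 t.2.1 t.2.2 || !trip T t.1 t.2.1 t.2.2)
    && (W.all fun w => !orb1 w M S && !orb1 w M T &&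
    (!okw w || act w M == M || !((act w S == S && act w T == T) || (act w S == T && act w T == S))))

/-- More conditions on the product. -/
def cand2 (W : List (List (ℕ × ℕ))) (S T M : List ℕ) : Bool :=
  cand W S T M && cand W M S M && cand W M T M

/-- Fast test for being a tree. -/
def isT (S : List ℕ) : Bool := clusters.filter S.contains == S && S.all fun a => S.all (cmp a)

theorem filter_mem_enum (p : ℕ → Bool) : ∀ l : List ℕ,
    (∀ a ∈ l, ∀ b ∈ l, p a = true → p b = true → cmp a b = true) → l.filter p ∈ enum l
  | [], _ => by simp [enum]
  | c :: cs, h => by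
    have ih := filter_mem_enum p cs (fun a ha b hb => h a (by simp [ha]) b (by simp [hb]))
    by_cases hc : p c = true
    · rw [List.filter_cons_of_pos hc, enum]
      refine List.mem_append_right _ (List.mem_map.2 ⟨_, List.mem_filter.2 ⟨ih, ?_⟩, rfl⟩)
      rw [List.all_eq_true]
      intro x hx
      obtain ⟨hx, hp⟩ := List.mem_filter.1 hx
      exact h c (by simp) x (by simp [hx]) hc hp
    · rw [List.filter_cons_of_neg hc, enum]
      exact List.mem_append_left _ ih

theorem isT_mem {S : List ℕ} (h : isT S = true) : S ∈ TL := by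
  simp only [isT, Bool.and_eq_true, beq_iff_eq, List.all_eq_true] at h
  have := filter_mem_enum S.contains clusters (by
    intro a _ b _ ha hb
    rw [List.contains_iff_mem] at ha hb
    exact h.2 a ha b hb)
  rw [h.1] at this
  exact this

variable {m : List ℕ → List ℕ → List ℕ}

theorem okw_lt {w : List (ℕ × ℕ)} (h : okw w = true) : ∀ p ∈ w, p.1 < 5 ∧ p.2 < 5 := by
  simp only [okw, List.all_eq_true, Bool.and_eq_true, Nat.blt_eq] at h
  exact h

theorem trips_ok : ∀ t ∈ trips, t.1 < 5 ∧ t.2.1 < 5 ∧ t.2.2 < 5 ∧ t.1 ≠ t.2.1 ∧ t.1 ≠ t.2.2 ∧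
    t.2.1 ≠ t.2.2 := by decide +kernel

namespace Ax

theorem act_mem (A : Ax m) (w : List (ℕ × ℕ)) (hw : ∀ p ∈ w, p.1 < 5 ∧ p.2 < 5) :
    ∀ T ∈ TL, act w T ∈ TL := by
  induction w with
  | nil => intro T hT; exact hT
  | cons p w ih =>
    intro T hT
    have h := hw p (by simp)
    exact ih (fun q hq => hw q (by simp [hq])) _ (A.actTL _ h.1 _ h.2 T hT)

theorem act_equi (A : Ax m) (w : List (ℕ × ℕ)) (hw : ∀ p ∈ w, p.1 < 5 ∧ p.2 < 5) :
    ∀ S ∈ TL, ∀ T ∈ TL, m (act w S) (act w T) = act w (m S T) := by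
  induction w with
  | nil => intro S _ T _; rfl
  | cons p w ih =>
    intro S hS T hT
    have h := hw p (by simp)
    have := ih (fun q hq => hw q (by simp [hq])) _ (A.actTL _ h.1 _ h.2 S hS) _
      (A.actTL _ h.1 _ h.2 T hT)
    simp only [act]
    rw [this, A.equi _ h.1 _ h.2 S hS T hT]

theorem le_act (A : Ax m) {S T : List ℕ} (h : le m S T) (w) (hw : okw w = true) :
    le m (act w S) (act w T) :=
  ⟨A.act_mem w (okw_lt hw) _ h.hS, A.act_mem w (okw_lt hw) _ h.hT, by
    rw [A.act_equi w (okw_lt hw) S h.hS T h.hT, h.eq]⟩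

theorem O (A : Ax m) {S T S' T' : List ℕ} (h : le m S T) {w} (hc : orb2 w S T S' T' = true) :
    le m S' T' := by
  simp only [orb2, Bool.and_eq_true, beq_iff_eq] at hc
  obtain ⟨⟨hw, rfl⟩, rfl⟩ := hc
  exact A.le_act h w hw

theorem trans (A : Ax m) {S T U : List ℕ} (h : le m S T) (h' : le m T U) : le m S U :=
  ⟨h.hS, h'.hT, by
    conv_lhs => rw [← h.eq]
    rw [A.assoc S h.hS T h.hT U h'.hT, h'.eq, h.eq]⟩

theorem antisymm (A : Ax m) {S T : List ℕ} (h : le m S T) (h' : le m T S) : S = T := by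
  rw [← h.eq, A.comm S h.hS T h.hT, h'.eq]

theorem refl (A : Ax m) {S : List ℕ} (h : S ∈ TL) : le m S S := ⟨h, h, A.idem S h⟩

theorem not_orb1 (A : Ax m) {S T : List ℕ} (h : le m S T) (w) : orb1 w S T = false := by
  by_contra hc
  simp only [orb1, List.any_eq_true, Bool.and_eq_true, beq_iff_eq, bne_iff_ne,
    Bool.not_eq_false] at hc
  obtain ⟨⟨⟨⟨-, hne⟩, hw⟩, rfl⟩, n, -, hn⟩ := hc
  have key : ∀ k, le m S ((act w)^[k] S) := by
    intro k
    induction k with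
    | zero => exact A.refl h.hS
    | succ k ih =>
      rw [Function.iterate_succ_apply']
      exact A.trans h (A.le_act ih w hw)
  have h2 := A.le_act (key n) w hw
  rw [← Function.iterate_succ_apply' (act w) n S, hn] at h2
  exact hne (A.antisymm h h2)

theorem lbl (A : Ax m) {S T : List ℕ} (hS : S ∈ TL) (hT : T ∈ TL) : le m (m S T) S :=
  ⟨A.closed S hS T hT, hS, by
    rw [A.comm S hS T hT, A.assoc T hT S hS S hS, A.idem S hS]⟩

theorem lbr (A : Ax m) {S T : List ℕ} (hS : S ∈ TL) (hT : T ∈ TL) : le m (m S T) T := by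
  rw [A.comm S hS T hT]; exact A.lbl hT hS

theorem mem_cand (A : Ax m) {S T : List ℕ} (hS : S ∈ TL) (hT : T ∈ TL) (W) :
    cand W S T (m S T) = true := by
  simp only [cand, Bool.and_eq_true, List.all_eq_true]
  refine ⟨?_, ?_⟩
  · intro t ht
    obtain ⟨p1, p2, p3, p4, p5, p6⟩ := trips_ok t ht
    have := A.pareto S hS T hT _ p1 _ p2 _ p3 p4 p5 p6
    cases h1 : trip S t.1 t.2.1 t.2.2 <;> cases h2 : trip T t.1 t.2.1 t.2.2 <;> simp_all
  · intro w hw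
    rw [A.not_orb1 (A.lbl hS hT), A.not_orb1 (A.lbr hS hT)]
    refine ⟨⟨rfl, rfl⟩, ?_⟩
    cases hk : okw w
    · rfl
    have := A.act_equi w (okw_lt hk) S hS T hT
    by_cases h : (act w S = S ∧ act w T = T) ∨ (act w S = T ∧ act w T = S)
    · have : act w (m S T) = m S T := by
        rcases h with ⟨h1, h2⟩ | ⟨h1, h2⟩
        · rw [← this, h1, h2]
        · rw [← this, h1, h2, A.comm T hT S hS]
      simp [this]
    · have : ((act w S == S && act w T == T) || (act w S == T && act w T == S)) = false := by
        rw [Bool.eq_false_iff]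
        simpa using h
      simp [this]

theorem mem_cand2 (A : Ax m) {S T : List ℕ} (hS : S ∈ TL) (hT : T ∈ TL) (W) :
    cand2 W S T (m S T) = true := by
  simp only [cand2, Bool.and_eq_true]
  refine ⟨⟨A.mem_cand hS hT W, ?_⟩, ?_⟩
  · have := A.mem_cand (A.closed S hS T hT) hS W
    rwa [(A.lbl hS hT).eq] at this
  · have := A.mem_cand (A.closed S hS T hT) hT W
    rwa [(A.lbr hS hT).eq] at this

theorem D (A : Ax m) (S T : List ℕ) (l : List (List ℕ)) (W : List (List (ℕ × ℕ)))
    (hS : (isT S && isT T && (TL.all fun M => !cand2 W S T M || l.contains M)) = true) :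
    m S T ∈ l := by
  simp only [Bool.and_eq_true, List.all_eq_true] at hS
  have h := hS.2 _ (A.closed S (isT_mem hS.1.1) T (isT_mem hS.1.2))
  rw [A.mem_cand2 (isT_mem hS.1.1) (isT_mem hS.1.2) W] at h
  simpa using h

theorem lb1 (A : Ax m) {S T M : List ℕ} (h : m S T = M)
    (hc : (isT S && isT T) = true := by decide +kernel) : le m M S := by
  simp only [Bool.and_eq_true] at hc
  rw [← h]; exact A.lbl (isT_mem hc.1) (isT_mem hc.2)

theorem lb2 (A : Ax m) {S T M : List ℕ} (h : m S T = M)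
    (hc : (isT S && isT T) = true := by decide +kernel) : le m M T := by
  simp only [Bool.and_eq_true] at hc
  rw [← h]; exact A.lbr (isT_mem hc.1) (isT_mem hc.2)

theorem glb (A : Ax m) (U : List ℕ) {S T M a b c d : List ℕ} (h : m S T = M) (q : le m a b)
    (q' : le m c d) (w v) (hc : (orb2 w a b U S && orb2 v c d U T) = true := by decide +kernel) :
    le m U M := by
  simp only [Bool.and_eq_true] at hc
  have h1 := A.O q hc.1
  have h2 := A.O q' hc.2
  rw [← h]
  refine ⟨h1.hS, A.closed S h1.hT T h2.hT, ?_⟩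
  rw [← A.assoc U h1.hS S h1.hT T h2.hT, h1.eq, h2.eq]

theorem tr (A : Ax m) (S T U : List ℕ) {a b c d : List ℕ} (q : le m a b)
    (q' : le m c d) (w v) (hc : (orb2 w a b S T && orb2 v c d T U) = true := by decide +kernel) :
    le m S U := by
  simp only [Bool.and_eq_true] at hc
  exact A.trans (A.O q hc.1) (A.O q' hc.2)

theorem no (A : Ax m) {S T : List ℕ} (q : le m S T) (w) (hc : orb1 w S T = true := by decide +kernel) :
    False := by
  rw [A.not_orb1 q] at hc; exact absurd hc (by simp)

theorem as (A : Ax m) (S T : List ℕ) {a b c d : List ℕ} (q : le m a b)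
    (q' : le m c d) (w v) (hc : (orb2 w a b S T && orb2 v c d T S && S != T) = true := by decide +kernel) :
    False := by
  simp only [Bool.and_eq_true, bne_iff_ne] at hc
  exact hc.2 (A.antisymm (A.O q hc.1.1) (A.O q' hc.1.2))

set_option maxHeartbeats 0 in
theorem contra (A : Ax m) : False := by
  have D1 := A.D [12, 18, 19] [12, 17, 19] [[12, 19]]
    [[(0, 1)], [(1, 4)]] (by decide +kernel)
  have D2 := A.D [24, 28, 30] [12, 18, 30] [[28, 30], [24, 28, 30], [12, 30], [12, 18, 30]]
    [[(2, 3)], [(2, 4)], [(1, 4), (2, 4)]] (by decide +kernel)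
  have D3 := A.D [24, 28, 30] [24, 26, 27] [[24, 30], [24, 26], [6, 24, 30], [5, 24, 26]]
    [[(1, 2)], [(0, 1), (1, 2)], [(0, 2), (1, 2)]] (by decide +kernel)
  have D4 := A.D [30] [12, 18] [[30], [12, 18], [12, 18, 30]]
    [[(1, 2), (2, 4), (3, 4)]] (by decide +kernel)
  have D5 := A.D [24, 28, 30] [24, 28, 29] [[24, 28], [3, 24, 28]]
    [[(0, 1)]] (by decide +kernel)
  have D6 := A.D [24, 28, 30] [24, 26, 30] [[24, 30], [6, 24, 30]]
    [[(1, 2)]] (by decide +kernel)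
  have D7 := A.D [12, 18, 30] [10, 20, 30] [[30]]
    [[(1, 3), (2, 4), (3, 4)], [(2, 3)]] (by decide +kernel)
  have D8 := A.D [12, 18, 30] [10, 17, 27] [[26], [24, 26], [5, 26], [5, 24, 26]]
    [[(0, 2), (3, 4)]] (by decide +kernel)
  have D9 := A.D [24, 28, 30] [20, 28, 30] [[28, 30]]
    [[(2, 3)], [(3, 4)]] (by decide +kernel)
  have D10 := A.D [12, 18, 19] [10, 14, 17] [[12, 17], [12, 17, 29]]
    [[(0, 2), (3, 4)]] (by decide +kernel)
  have D11 := A.D [24, 30] [6, 30] [[30], [6, 24, 30]]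
    [[(1, 3), (2, 4), (3, 4)]] (by decide +kernel)
  have D12 := A.D [24, 28, 30] [20, 22, 30] [[28, 30], [20, 30], [10, 20, 30]]
    [[(2, 3)], [(2, 4)], [(1, 2), (2, 3)], [(1, 3), (2, 3)]] (by decide +kernel)
  simp only [List.mem_cons, List.not_mem_nil, or_false] at D1 D2 D3 D4 D5 D6 D7 D8 D9 D10 D11 D12
  have q1 := A.lb1 D1
  have q2 := A.lb1 D7
  rcases D6 with hD6 | hD6
  · have q3 := A.lb1 hD6
    rcases D10 with hD10 | hD10
    · have q4 := A.lb1 hD10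
      have q5 := A.glb [3, 12] D1 q4 q4 [(1, 4)] [(0, 4), (1, 4)]
      have q6 := A.tr [12, 17] [14, 17] [12, 14, 17] q5 q1 [(0, 2), (1, 4), (3, 4)] [(0, 2), (1, 2), (3, 4)]
      rcases D8 with hD8 | hD8 | hD8 | hD8
      · have q7 := A.lb1 hD8
        have q8 := A.glb [28] D7 q7 q7 [(1, 2), (3, 4)] [(1, 2)]
        rcases D2 with hD2 | hD2 | hD2 | hD2
        · have q9 := A.lb2 hD2
          have q10 := A.glb [28, 30] D7 q9 q9 [] [(3, 4)]
          rcases D11 with hD11 | hD11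
          · have q11 := A.lb1 hD11
            have q12 := A.tr [30] [24, 30] [24, 28, 30] q11 q3 [] []
            have q13 := A.tr [28, 30] [30] [24, 26, 30] q10 q12 [] [(1, 2)]
            have q14 := A.glb [26, 30] hD2 q13 q9 [(1, 2)] [(1, 2), (3, 4)]
            exact A.no q14 [(1, 2)]
          · have q15 := A.lb1 hD11
            have q16 := A.tr [6, 24, 30] [24, 30] [24, 28, 30] q15 q3 [] []
            have q17 := A.tr [28, 30] [12, 18, 30] [18, 26, 30] q9 q16 [] [(1, 3), (2, 3)]
            have q18 := A.glb [14, 30] D9 q17 q17 [(1, 2), (2, 3), (3, 4)] [(1, 2), (2, 4)]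
            exact A.no q18 [(1, 4)]
        · have q19 := A.lb2 hD2
          have q20 := A.glb [24, 28, 30] D7 q19 q19 [] [(3, 4)]
          rcases D11 with hD11 | hD11
          · have q21 := A.lb1 hD11
            have q22 := A.tr [30] [24, 30] [24, 28, 30] q21 q3 [] []
            have q23 := A.tr [24, 28, 30] [30] [6, 22, 30] q20 q22 [] [(1, 3), (2, 4)]
            have q24 := A.tr [6, 22, 30] [24, 28, 30] [6, 14, 30] q23 q23 [(1, 3), (2, 4)] [(3, 4)]
            exact A.no q24 [(3, 4)]
          · have q25 := A.lb1 hD11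
            have q26 := A.tr [6, 24, 30] [24, 30] [24, 28, 30] q25 q3 [] []
            have q27 := A.tr [24, 28, 30] [12, 18, 30] [18, 22, 30] q19 q26 [] [(1, 3)]
            exact A.no q27 [(1, 3)]
        · have q28 := A.lb1 hD2
          have q29 := A.lb2 hD2
          have q30 := A.glb [12, 30] D9 q28 q28 [] [(2, 3)]
          rcases D12 with hD12 | hD12 | hD12
          · have q31 := A.lb2 hD12
            have q32 := A.tr [24, 30] [28, 30] [20, 22, 30] q30 q31 [(2, 4)] []
            have q33 := A.glb [18, 30] hD2 q32 q29 [(1, 3), (2, 3)] [(1, 2), (3, 4)]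
            exact A.no q33 [(1, 2), (3, 4)]
          · rcases D11 with hD11 | hD11
            · have q34 := A.lb1 hD11
              have q35 := A.tr [28] [30] [24, 30] q8 q34 [] []
              have q36 := A.tr [30] [24, 30] [24, 28, 30] q34 q3 [] []
              rcases D3 with hD3 | hD3 | hD3 | hD3
              · have q37 := A.lb2 hD3
                have q38 := A.tr [28] [24, 30] [24, 26, 27] q35 q37 [] []
                have q39 := A.glb [25] hD6 q38 q38 [(0, 2), (1, 2)] [(0, 2)]
                have q40 := A.tr [25] [24, 30] [6, 24, 30] q39 q29 [] [(2, 4)]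
                have q41 := A.glb [19] hD8 q40 q7 [(1, 3)] [(0, 1), (1, 3), (2, 3)]
                exact A.no q41 [(0, 3)]
              · have q42 := A.lb1 hD3
                have q43 := A.lb2 hD3
                have q44 := A.glb [24, 28] hD6 q43 q42 [(0, 2), (1, 2)] [(1, 2)]
                have q45 := A.tr [24, 28] [24, 30] [20, 28, 30] q44 q28 [] [(2, 4), (3, 4)]
                rcases D5 with hD5 | hD5
                · have q46 := A.glb [20, 28] hD5 q45 q45 [(2, 3)] [(0, 1), (2, 3)]
                  exact A.no q46 [(2, 3)]
                · have q47 := A.lb1 hD5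
                  have q48 := A.tr [12, 18] [12, 18, 19] [18, 19, 27] q6 q47 [(0, 1), (1, 2), (3, 4)] [(0, 2), (1, 3)]
                  have q49 := A.glb [20, 28] hD5 q45 q45 [(2, 3)] [(0, 1), (2, 3)]
                  rcases D4 with hD4 | hD4 | hD4
                  · have q50 := A.lb2 hD4
                    have q51 := A.tr [30] [12, 18] [18, 19, 27] q50 q48 [] []
                    have q52 := A.tr [28] [30] [24, 25, 27] q8 q51 [] [(1, 3)]
                    have q53 := A.glb [25] hD6 q52 q52 [(0, 2)] [(0, 2), (1, 2)]
                    have q54 := A.tr [25] [24, 30] [6, 24, 30] q53 q29 [] [(2, 4)]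
                    have q55 := A.glb [19] hD8 q54 q7 [(1, 3)] [(0, 1), (1, 3), (2, 3)]
                    exact A.no q55 [(0, 3)]
                  · have q56 := A.lb1 hD4
                    have q57 := A.tr [12, 18] [30] [18, 26, 30] q56 q36 [] [(1, 3), (2, 3)]
                    have q58 := A.glb [3, 24] hD3 q48 q57 [(0, 2), (1, 3)] [(0, 2), (1, 3)]
                    have q59 := A.tr [6, 24] [24, 28] [3, 20, 28] q58 q49 [(0, 2), (1, 2)] [(2, 3)]
                    have q60 := A.glb [6, 17] hD10 q59 q4 [(0, 3), (1, 2)] [(0, 2), (1, 4), (3, 4)]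
                    exact A.no q60 [(1, 3)]
                  · have q61 := A.lb1 hD4
                    exact A.as [30] [12, 18, 30] q2 q61 [] []
              · have q62 := A.lb1 hD3
                have q63 := A.tr [18, 30] [12, 18, 30] [12, 28, 30] q29 q62 [(1, 2), (3, 4)] [(2, 4)]
                have q64 := A.glb [6, 30] hD12 q63 q28 [(2, 4)] [(1, 2), (2, 3)]
                exact A.no q64 [(1, 4)]
              · have q65 := A.lb1 hD3
                have q66 := A.tr [12, 17] [12, 18, 19] [18, 26, 27] q4 q65 [] [(0, 1), (1, 3), (2, 3)]
                have q67 := A.lb2 hD3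
                have q68 := A.tr [12, 18] [12, 18, 19] [18, 19, 27] q6 q67 [(0, 1), (1, 2), (3, 4)] [(0, 1), (1, 3)]
                have q69 := A.glb [3, 24] hD12 q68 q66 [(0, 2), (1, 3)] [(0, 2), (1, 3), (2, 3)]
                have q70 := A.tr [5, 18] [24, 30] [12, 28, 30] q69 q28 [(1, 3), (2, 3)] [(2, 4)]
                have q71 := A.glb [6, 17] hD3 q70 q66 [(2, 4)] [(1, 3)]
                have q72 := A.glb [9, 20] hD10 q71 q71 [(0, 1), (1, 3), (2, 3)] [(1, 3), (2, 3), (3, 4)]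
                exact A.no q72 [(3, 4)]
            · have q73 := A.lb1 hD11
              have q74 := A.tr [6, 24, 30] [24, 30] [24, 28, 30] q73 q3 [] []
              have q75 := A.tr [18, 30] [12, 18, 30] [12, 28, 30] q29 q74 [(1, 2), (3, 4)] [(2, 4)]
              have q76 := A.glb [6, 30] hD12 q75 q28 [(2, 4)] [(1, 2), (2, 3)]
              exact A.no q76 [(1, 4)]
          · have q77 := A.lb1 hD12
            have q78 := A.glb [12, 18, 30] hD6 q77 q77 [(3, 4)] [(1, 2)]
            rcases D11 with hD11 | hD11
            · have q79 := A.glb [12, 18, 30] hD11 q78 q78 [] [(1, 3), (2, 4)]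
              exact A.as [30] [12, 18, 30] q2 q79 [] []
            · have q80 := A.glb [12, 18, 30] hD11 q78 q78 [] [(1, 3), (2, 4)]
              exact A.no q80 [(2, 4)]
        · have q81 := A.lb1 hD2
          have q82 := A.glb [12, 18, 30] hD6 q81 q81 [] [(1, 2), (3, 4)]
          rcases D11 with hD11 | hD11
          · have q83 := A.glb [12, 18, 30] hD11 q82 q82 [] [(1, 3), (2, 4)]
            exact A.as [30] [12, 18, 30] q2 q83 [] []
          · have q84 := A.glb [12, 18, 30] hD11 q82 q82 [] [(1, 3), (2, 4)]
            exact A.no q84 [(2, 4)]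
      · have q85 := A.lb1 hD8
        have q86 := A.glb [24, 28] D7 q85 q85 [(1, 2), (3, 4)] [(1, 2)]
        have q87 := A.tr [24, 28] [30] [6, 24, 30] q86 q2 [] [(2, 4)]
        have q88 := A.glb [18, 26] hD8 q87 q85 [(1, 3), (2, 3)] [(0, 2), (1, 4), (3, 4)]
        exact A.no q88 [(1, 3)]
      · have q89 := A.lb1 hD8
        have q90 := A.tr [12, 17] [14, 17] [10, 20, 30] q5 q89 [(0, 2), (1, 4), (3, 4)] [(2, 3), (3, 4)]
        have q91 := A.glb [9, 20] hD8 q90 q90 [(3, 4)] [(0, 2)]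
        have q92 := A.tr [9, 20] [14, 17] [10, 14, 17] q91 q1 [(2, 4)] [(0, 2), (3, 4)]
        have q93 := A.glb [9, 20] hD10 q92 q92 [(0, 2), (3, 4)] []
        exact A.no q93 [(3, 4)]
      · have q94 := A.lb1 hD8
        have q95 := A.tr [12, 17] [12, 18, 19] [3, 24, 27] q4 q94 [] [(0, 1), (1, 4), (2, 4), (3, 4)]
        have q96 := A.glb [6, 9] hD8 q95 q95 [(0, 2), (1, 2), (2, 4)] [(1, 3), (3, 4)]
        have q97 := A.glb [9, 20] hD10 q96 q96 [(0, 1), (1, 4), (2, 4), (3, 4)] [(1, 4), (2, 4)]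
        exact A.no q97 [(3, 4)]
    · have q98 := A.lb1 hD10
      rcases D8 with hD8 | hD8 | hD8 | hD8
      · have q99 := A.lb1 hD8
        have q100 := A.tr [28] [12, 18, 30] [9, 13, 18] q99 q98 [(1, 2), (3, 4)] [(0, 1), (1, 2), (3, 4)]
        have q101 := A.glb [7] hD10 q100 q100 [(0, 2), (1, 3), (2, 4)] [(0, 4), (1, 3), (3, 4)]
        have q102 := A.glb [7] hD8 q101 q101 [(0, 1)] [(1, 2)]
        have q103 := A.tr [19] [28] [11] q102 q102 [(1, 2), (2, 4)] [(0, 4), (1, 3)]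
        exact A.no q103 [(3, 4)]
      · have q104 := A.lb1 hD8
        have q105 := A.glb [24, 28] D7 q104 q104 [(1, 2), (3, 4)] [(1, 2)]
        have q106 := A.tr [24, 28] [30] [6, 24, 30] q105 q2 [] [(2, 4)]
        have q107 := A.glb [18, 26] hD8 q106 q104 [(1, 3), (2, 3)] [(0, 2), (1, 4), (3, 4)]
        exact A.no q107 [(1, 3)]
      · have q108 := A.lb1 hD8
        have q109 := A.tr [14, 17] [12, 18, 30] [3, 12, 19] q108 q98 [(1, 3), (2, 4)] [(0, 1), (1, 4)]
        have q110 := A.glb [3, 28] D1 q109 q109 [(0, 4), (1, 4)] [(1, 4)]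
        exact A.no q110 [(0, 2), (1, 3)]
      · have q111 := A.lb1 hD8
        have q112 := A.tr [10, 14, 17] [12, 18, 30] [3, 12, 19] q111 q98 [(1, 3), (2, 3), (3, 4)] [(0, 1), (1, 4)]
        have q113 := A.tr [10, 14, 17] [12, 18, 19] [6, 14, 17] q112 q112 [(0, 4)] [(0, 2), (3, 4)]
        exact A.no q113 [(2, 3)]
  · have q114 := A.lb1 hD6
    rcases D2 with hD2 | hD2 | hD2 | hD2
    · have q115 := A.lb2 hD2
      have q116 := A.tr [28, 30] [12, 18, 30] [18, 26, 30] q115 q114 [] [(1, 3), (2, 3)]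
      have q117 := A.glb [14, 30] D9 q116 q116 [(1, 2), (2, 3), (3, 4)] [(1, 2), (2, 4)]
      exact A.no q117 [(1, 4)]
    · have q118 := A.lb2 hD2
      have q119 := A.tr [24, 28, 30] [12, 18, 30] [18, 22, 30] q118 q114 [] [(1, 3)]
      exact A.no q119 [(1, 3)]
    · have q120 := A.lb2 hD2
      have q121 := A.lb1 hD2
      have q122 := A.tr [18, 30] [12, 18, 30] [12, 28, 30] q120 q114 [(1, 2), (3, 4)] [(2, 4)]
      have q123 := A.glb [12, 30] D9 q121 q121 [] [(2, 3)]
      rcases D12 with hD12 | hD12 | hD12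
      · have q124 := A.lb2 hD12
        have q125 := A.tr [24, 30] [28, 30] [20, 22, 30] q123 q124 [(2, 4)] []
        have q126 := A.glb [18, 30] hD2 q125 q120 [(1, 3), (2, 3)] [(1, 2), (3, 4)]
        exact A.no q126 [(1, 2), (3, 4)]
      · have q127 := A.glb [6, 30] hD12 q122 q121 [(2, 4)] [(1, 2), (2, 3)]
        exact A.no q127 [(1, 4)]
      · have q128 := A.lb1 hD12
        have q129 := A.glb [12, 18, 30] hD6 q128 q128 [(3, 4)] [(1, 2)]
        exact A.no q129 [(2, 4)]
    · have q130 := A.lb1 hD2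
      have q131 := A.glb [12, 18, 30] hD6 q130 q130 [] [(1, 2), (3, 4)]
      exact A.no q131 [(2, 4)]

end Ax

end Code

/-! ### Transfer to trees on a finite set -/

namespace Code

/-- A cluster of `T` contains `x, y` but not `z`. -/
def sep {α : Type*} (T : Set (Set α)) (x y z : α) : Prop := ∃ C ∈ T, x ∈ C ∧ y ∈ C ∧ z ∉ C

/-- The properties of the binary operation that are used. -/
structure Op {α : Type*} (X : Set α) (m : Set (Set α) → Set (Set α) → Set (Set α)) : Prop where
  closed : ∀ S ∈ RP X, ∀ T ∈ RP X, m S T ∈ RP X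
  idem : ∀ T ∈ RP X, m T T = T
  comm : ∀ S ∈ RP X, ∀ T ∈ RP X, m S T = m T S
  assoc : ∀ S ∈ RP X, ∀ T ∈ RP X, ∀ U ∈ RP X, m (m S T) U = m S (m T U)
  equi : ∀ σ : α → α, Set.BijOn σ X X → ∀ S ∈ RP X, ∀ T ∈ RP X,
    m (mapTree σ S) (mapTree σ T) = mapTree σ (m S T)
  pareto : ∀ S ∈ RP X, ∀ T ∈ RP X, ∀ x ∈ X, ∀ y ∈ X, ∀ z ∈ X, x ≠ y → x ≠ z → y ≠ z →
    sep S x y z → sep T x y z → sep (m S T) x y z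

theorem triple_RP {α : Type*} {x y z : α} :
    ({{x}, {y}, {z}, {x, y}, {x, y, z}} : Set (Set α)) ∈ RP ({x, y, z} : Set α) := by
  refine ⟨?_, by simp, ?_, ?_⟩
  · rintro C (rfl | rfl | rfl | rfl | rfl) <;> constructor <;>
      first | (intro w hw; simp only [mem_insert_iff, mem_singleton_iff] at hw ⊢; tauto) | simp
  · rintro w (rfl | rfl | rfl) <;> simp
  · have key : ∀ A B : Set α, (∃ w, A = {w}) → A ∩ B = ∅ ∨ A ∩ B = A ∨ A ∩ B = B := by
      rintro A B ⟨w, rfl⟩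
      by_cases h : w ∈ B
      · right; left; simpa using h
      · left; simpa using h
    have key2 : ∀ A B : Set α, (∃ w, B = {w}) → A ∩ B = ∅ ∨ A ∩ B = A ∨ A ∩ B = B := by
      intro A B h
      have := key B A h
      rw [inter_comm] at this
      tauto
    have hs : ({x, y} : Set α) ⊆ {x, y, z} := by
      intro w hw; simp only [mem_insert_iff, mem_singleton_iff] at hw ⊢; tauto
    rintro A hA B hB
    rcases hA with rfl | rfl | rfl | rfl | rfl
    · exact key _ _ ⟨_, rfl⟩
    · exact key _ _ ⟨_, rfl⟩
    · exact key _ _ ⟨_, rfl⟩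
    all_goals
      rcases hB with rfl | rfl | rfl | rfl | rfl
      · exact key2 _ _ ⟨_, rfl⟩
      · exact key2 _ _ ⟨_, rfl⟩
      · exact key2 _ _ ⟨_, rfl⟩
      all_goals first
        | (right; left; exact inter_self _)
        | (right; left; exact inter_eq_left.2 hs)
        | (right; right; exact inter_eq_right.2 hs)

theorem triple_sub {α : Type*} {X : Set α} {T : Set (Set α)} (hT : T ∈ RP X) {x y z : α}
    (hx : x ∈ X) (hy : y ∈ X) (hz : z ∈ X) (h : sep T x y z) :
    ({{x}, {y}, {z}, {x, y}, {x, y, z}} : Set (Set α)) ⊆ restrictTree {x, y, z} T := by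
  obtain ⟨C, hC, h1, h2, h3⟩ := h
  have hs : ∀ w ∈ X, w ∈ ({x, y, z} : Set α) → ({w} : Set α) ∈ restrictTree {x, y, z} T := by
    intro w hw hw2
    have : ({w} : Set α) ∩ {x, y, z} = {w} := inter_eq_left.2 (by simpa using hw2)
    exact ⟨{w}, hT.2.2.1 w hw, this.symm, by rw [this]; simp⟩
  rintro D (rfl | rfl | rfl | rfl | rfl)
  · exact hs _ hx (by simp)
  · exact hs _ hy (by simp)
  · exact hs _ hz (by simp)
  · refine ⟨C, hC, ?_, ⟨x, h1, by simp⟩⟩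
    ext w
    simp only [mem_insert_iff, mem_singleton_iff, mem_inter_iff]
    constructor
    · rintro (rfl | rfl) <;> simp [h1, h2]
    · rintro ⟨hw, rfl | rfl | rfl⟩ <;> simp_all
  · refine ⟨X, hT.2.1, ?_, ⟨x, hx, by simp⟩⟩
    symm
    apply inter_eq_right.2
    rintro w (rfl | rfl | rfl) <;> assumption

theorem op_of {α : Type*} {X : Set α} {φ : (k : ℕ) → (Fin k → Set (Set α)) → Set (Set α)}
    (h : IsRegularAssocStablePareto X φ) : Op X (fun S T => φ 2 ![S, T]) := by
  obtain ⟨hcl, hun, han, hne, hst, hpa⟩ := h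
  have hmem : ∀ S ∈ RP X, ∀ T ∈ RP X, ∀ i, (![S, T] : Fin 2 → Set (Set α)) i ∈ RP X := by
    intro S hS T hT i
    fin_cases i
    · exact hS
    · exact hT
  have hcomm : ∀ S ∈ RP X, ∀ T ∈ RP X, φ 2 ![S, T] = φ 2 ![T, S] := by
    intro S hS T hT
    have := han 2 (by norm_num) ![T, S] (hmem T hT S hS) (Equiv.swap 0 1)
    rw [← this]
    congr 1
    funext i
    fin_cases i <;> simp
  have hclosed : ∀ S ∈ RP X, ∀ T ∈ RP X, φ 2 ![S, T] ∈ RP X := fun S hS T hT =>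
    hcl 2 (by norm_num) _ (hmem S hS T hT)
  have h3 : ∀ S ∈ RP X, ∀ T ∈ RP X, ∀ U ∈ RP X, φ 3 ![S, T, U] = φ 2 ![φ 2 ![S, T], U] := by
    intro S hS T hT U hU
    have := hst 1 ![S, T, U] (by intro i; fin_cases i <;> assumption)
    rw [this]
    congr 2
    change φ 2 _ = _
    congr 1
    funext i
    fin_cases i <;> rfl
  have hcyc : ∀ S ∈ RP X, ∀ T ∈ RP X, ∀ U ∈ RP X, φ 3 ![T, U, S] = φ 3 ![S, T, U] := by
    intro S hS T hT U hU
    have := han 3 (by norm_num) ![S, T, U] (by intro i; fin_cases i <;> assumption) (finRotate 3)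
    rw [← this]
    congr 1
    funext i
    fin_cases i <;> rfl
  refine ⟨hclosed, ?_, hcomm, ?_, ?_, ?_⟩
  · intro T hT
    have := hun 2 (by norm_num) T hT
    have e : (![T, T] : Fin 2 → Set (Set α)) = fun _ => T := by
      funext i; fin_cases i <;> rfl
    simpa only [e] using this
  · intro S hS T hT U hU
    change φ 2 ![φ 2 ![S, T], U] = φ 2 ![S, φ 2 ![T, U]]
    rw [← h3 S hS T hT U hU, ← hcyc S hS T hT U hU, h3 T hT U hU S hS,
      hcomm _ (hclosed T hT U hU) S hS]
  · intro σ hσ S hS T hT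
    have := hne 2 (by norm_num) σ hσ ![S, T] (hmem S hS T hT)
    change φ 2 ![mapTree σ S, mapTree σ T] = mapTree σ (φ 2 ![S, T])
    rw [← this]
    congr 1
    funext i
    fin_cases i <;> rfl
  · intro S hS T hT x hx y hy z hz hxy hxz hyz h1 h2
    have := hpa 2 (by norm_num) {x, y, z} (by rintro w (rfl | rfl | rfl) <;> assumption)
      (Set.ncard_eq_three.2 ⟨x, y, z, hxy, hxz, hyz, rfl⟩) _ triple_RP ![S, T] (hmem S hS T hT)
      (by
        intro i
        fin_cases i
        · exact triple_sub hS hx hy hz h1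
        · exact triple_sub hT hx hy hz h2)
    obtain ⟨C, hC, hCe, -⟩ := this (show ({x, y} : Set α) ∈ _ by simp)
    have ex : x ∈ C ∩ {x, y, z} := by rw [← hCe]; simp
    have ey : y ∈ C ∩ {x, y, z} := by rw [← hCe]; simp
    refine ⟨C, hC, ex.1, ey.1, fun hzC => ?_⟩
    have ez : z ∈ ({x, y} : Set α) := by rw [hCe]; exact ⟨hzC, by simp⟩
    rcases ez with rfl | rfl
    · exact hxz rfl
    · exact hyz rfl

theorem sep_mem {α : Type*} {X : Set α} (hX : X.Finite) {T : Set (Set α)} (hT : T ∈ RP X)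
    {P : Set α} (hP : P ⊆ X) (hne : P.Nonempty)
    (h : ∀ y ∈ P, ∀ y' ∈ P, ∀ z ∈ X, z ∉ P → sep T y y' z) : P ∈ T := by
  have hfin : T.Finite := hX.finite_subsets.subset fun C hC => (hT.1 C hC).1
  obtain ⟨C, hC⟩ := (hfin.subset (sep_subset T fun C => P ⊆ C)).exists_minimal ⟨X, hT.2.1, hP⟩
  obtain ⟨⟨hCT, hPC⟩, hmin⟩ := hC
  by_cases hCP : C ⊆ P
  · rwa [hPC.antisymm hCP]
  exfalso
  obtain ⟨z, hzC, hzP⟩ := not_subset.1 hCP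
  have hzX := (hT.1 C hCT).1 hzC
  obtain ⟨y, hy⟩ := hne
  obtain ⟨E, hE, hyE, -, hzE⟩ := h y hy y hy z hzX hzP
  obtain ⟨D, hD⟩ := (hfin.subset (sep_subset T fun D => y ∈ D ∧ z ∉ D)).exists_maximal
    ⟨E, hE, hyE, hzE⟩
  obtain ⟨⟨hDT, hyD, hzD⟩, hmax⟩ := hD
  have hPD : P ⊆ D := by
    intro w hw
    obtain ⟨G, hG, hyG, hwG, hzG⟩ := h y hy w hw z hzX hzP
    rcases hT.2.2.2 D hDT G hG with h0 | h0 | h0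
    · exact absurd (show y ∈ D ∩ G from ⟨hyD, hyG⟩) (by rw [h0]; simp)
    · exact hmax ⟨hG, hyG, hzG⟩ (inter_eq_left.1 h0) hwG
    · exact inter_eq_right.1 h0 hwG
  rcases hT.2.2.2 D hDT C hCT with h0 | h0 | h0
  · exact absurd (show y ∈ D ∩ C from ⟨hyD, hPC hy⟩) (by rw [h0]; simp)
  · exact hzD (hmin ⟨hDT, hPD⟩ (inter_eq_left.1 h0) hzC)
  · exact hzD (inter_eq_right.1 h0 hzC)

/-- `g` enumerates `X` by the numbers below `n`. -/
structure En {α : Type*} (X : Set α) (g : ℕ → α) (n : ℕ) : Prop where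
  five : 5 ≤ n
  inj : ∀ i < n, ∀ j < n, g i = g j → i = j
  mem : ∀ x, x ∈ X ↔ ∃ i < n, g i = x

theorem exists_En {α : Type*} (X : Set α) (hX : X.Finite) (h5 : 5 ≤ X.ncard) :
    ∃ g : ℕ → α, En X g X.ncard := by
  have : Finite X := hX
  have hc : Nat.card X = X.ncard := rfl
  obtain ⟨x0, -⟩ : X.Nonempty := by
    rw [← Set.ncard_pos hX]; omega
  let e := Finite.equivFin X
  refine ⟨fun i => if h : i < Nat.card X then (e.symm ⟨i, h⟩ : α) else x0, h5, ?_, ?_⟩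
  · intro i hi j hj hij
    rw [← hc] at hi hj
    simp only [hi, hj, dif_pos] at hij
    have := e.symm.injective (Subtype.ext hij)
    exact congrArg Fin.val this
  · intro x
    constructor
    · intro hx
      refine ⟨e ⟨x, hx⟩, ?_, ?_⟩
      · rw [← hc]; exact (e ⟨x, hx⟩).2
      · change (if h : (e ⟨x, hx⟩ : ℕ) < Nat.card X then (e.symm ⟨e ⟨x, hx⟩, h⟩ : α) else x0) = x
        rw [dif_pos (e ⟨x, hx⟩).2]
        exact congrArg Subtype.val (e.symm_apply_apply ⟨x, hx⟩)
    · rintro ⟨i, hi, rfl⟩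
      rw [← hc] at hi
      change (if h : i < Nat.card X then (e.symm ⟨i, h⟩ : α) else x0) ∈ X
      rw [dif_pos hi]
      exact (e.symm ⟨i, hi⟩).2

/-- The first `k` leaves. -/
def P {α : Type*} (g : ℕ → α) (k : ℕ) : Set α := {x | ∃ i < k, g i = x}

/-- The cluster of a mask. -/
def ms {α : Type*} (g : ℕ → α) (c : ℕ) : Set α := {x | ∃ i < 5, c.testBit i = true ∧ g i = x}

/-- Decoding. -/
def dec {α : Type*} (X : Set α) (g : ℕ → α) (n : ℕ) (T : List ℕ) : Set (Set α) :=
  {C | (∃ x ∈ X, C = {x}) ∨ (∃ c ∈ T, C = ms g c) ∨ ∃ k, 5 ≤ k ∧ k ≤ n ∧ C = P g k}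

open Classical in
/-- Encoding. -/
noncomputable def enc {α : Type*} (g : ℕ → α) (T : Set (Set α)) : List ℕ :=
  clusters.filter fun c => decide (ms g c ∈ T)

/-- Trees containing the outer clusters. -/
structure Fam {α : Type*} (X : Set α) (g : ℕ → α) (n : ℕ) (T : Set (Set α)) : Prop where
  rp : T ∈ RP X
  out : ∀ k, 5 ≤ k → k ≤ n → P g k ∈ T

theorem clusters_lt : ∀ c ∈ clusters, c < 31 := by decide +kernel

theorem clusters_two : ∀ c ∈ clusters, ∃ i < 5, ∃ j < 5, i ≠ j ∧ c.testBit i = true ∧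
    c.testBit j = true := by decide +kernel

theorem clusters_miss : ∀ c ∈ clusters, ∃ i < 5, c.testBit i = false := by decide +kernel

theorem mask_cases : ∀ c < 32, c ∈ clusters ∨ c = 0 ∨ c = 31 ∨ ∃ i < 5, c = 2 ^ i := by
  decide +kernel

theorem TL_isT : ∀ T ∈ TL, isT T = true := by
  have : TL.all isT = true := by decide +kernel
  exact List.all_eq_true.1 this

theorem TL_clusters {T : List ℕ} (h : T ∈ TL) : ∀ c ∈ T, c ∈ clusters := by
  have := TL_isT T h
  simp only [isT, Bool.and_eq_true, beq_iff_eq] at this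
  intro c hc
  rw [← this.1] at hc
  exact (List.mem_filter.1 hc).1

theorem TL_cmp {T : List ℕ} (h : T ∈ TL) : ∀ a ∈ T, ∀ b ∈ T, cmp a b = true := by
  have := TL_isT T h
  simp only [isT, Bool.and_eq_true, List.all_eq_true] at this
  exact this.2

/-- The swap on leaf numbers. -/
def swn (i j l : ℕ) : ℕ := if l = i then j else if l = j then i else l

theorem sw_bit : ∀ i < 5, ∀ j < 5, ∀ c < 32, ∀ l < 5,
    (sw i j c).testBit l = c.testBit (swn i j l) := by decide +kernel

theorem sw_clusters : ∀ i < 5, ∀ j < 5, ∀ c ∈ clusters, sw i j c ∈ clusters := by decide +kernel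

namespace En

variable {X : Set α} {g : ℕ → α} {n : ℕ}

theorem gX (E : En X g n) {i : ℕ} (hi : i < n) : g i ∈ X := (E.mem _).2 ⟨i, hi, rfl⟩

theorem g_ms (E : En X g n) {i : ℕ} (hi : i < n) (c : ℕ) :
    g i ∈ ms g c ↔ i < 5 ∧ c.testBit i = true := by
  constructor
  · rintro ⟨j, hj, hb, he⟩
    obtain rfl := E.inj j (by have := E.five; omega) i hi he
    exact ⟨hj, hb⟩
  · rintro ⟨h1, h2⟩
    exact ⟨i, h1, h2, rfl⟩

theorem g_P (E : En X g n) {i : ℕ} (hi : i < n) {k : ℕ} (hk : k ≤ n) : g i ∈ P g k ↔ i < k := by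
  constructor
  · rintro ⟨j, hj, he⟩
    obtain rfl := E.inj j (by omega) i hi he
    exact hj
  · intro h
    exact ⟨i, h, rfl⟩

theorem P_mono {k l : ℕ} (h : k ≤ l) : P g k ⊆ P g l := by
  rintro x ⟨i, hi, rfl⟩; exact ⟨i, by omega, rfl⟩

theorem ms_P (c : ℕ) : ms g c ⊆ P g 5 := by
  rintro x ⟨i, hi, -, rfl⟩; exact ⟨i, hi, rfl⟩

theorem P_n (E : En X g n) : P g n = X := by
  ext x; exact (E.mem x).symm

theorem ms_and (E : En X g n) (a b : ℕ) : ms g (a &&& b) = ms g a ∩ ms g b := by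
  have h5 := E.five
  ext x
  constructor
  · rintro ⟨i, hi, h, rfl⟩
    rw [Nat.testBit_and, Bool.and_eq_true] at h
    exact ⟨⟨i, hi, h.1, rfl⟩, ⟨i, hi, h.2, rfl⟩⟩
  · rintro ⟨⟨i, hi, h, rfl⟩, h2⟩
    rw [E.g_ms (by omega)] at h2
    exact ⟨i, hi, by rw [Nat.testBit_and, h, h2.2]; rfl, rfl⟩

theorem ms_zero : ms g 0 = ∅ := by
  ext x; simp [ms]

theorem ms_inj (E : En X g n) {a b : ℕ} (ha : a < 32) (hb : b < 32) (h : ms g a = ms g b) :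
    a = b := by
  have h5 := E.five
  apply Nat.eq_of_testBit_eq
  intro i
  by_cases hi : i < 5
  · have := E.g_ms (i := i) (by omega) a
    rw [h, E.g_ms (by omega)] at this
    rw [Bool.eq_iff_iff]
    tauto
  · have h32 : 32 ≤ 2 ^ i := by
      calc 32 = 2 ^ 5 := by norm_num
        _ ≤ 2 ^ i := Nat.pow_le_pow_right (by norm_num) (by omega)
    rw [Nat.testBit_lt_two_pow (by omega), Nat.testBit_lt_two_pow (by omega)]

theorem compat_symm {A B : Set α} (h : A ∩ B = ∅ ∨ A ∩ B = A ∨ A ∩ B = B) :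
    B ∩ A = ∅ ∨ B ∩ A = B ∨ B ∩ A = A := by
  rw [inter_comm]; tauto

theorem compat_sub {A B : Set α} (h : A ⊆ B) : A ∩ B = ∅ ∨ A ∩ B = A ∨ A ∩ B = B :=
  Or.inr (Or.inl (inter_eq_left.2 h))

theorem compat_single (x : α) (B : Set α) :
    ({x} : Set α) ∩ B = ∅ ∨ ({x} : Set α) ∩ B = {x} ∨ ({x} : Set α) ∩ B = B := by
  by_cases h : x ∈ B
  · right; left; simpa using h
  · left; simpa using h

theorem dec_fam (E : En X g n) {T : List ℕ} (hT : T ∈ TL) : Fam X g n (dec X g n T) := by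
  have h5 := E.five
  have hms : ∀ c, ms g c ⊆ X := fun c =>
    (ms_P c).trans ((P_mono h5).trans E.P_n.subset)
  refine ⟨⟨?_, ?_, ?_, ?_⟩, ?_⟩
  · rintro C (⟨x, hx, rfl⟩ | ⟨c, hc, rfl⟩ | ⟨k, hk, hk', rfl⟩)
    · exact ⟨by simpa using hx, by simp⟩
    · obtain ⟨i, hi, -, -, -, hb, -⟩ := clusters_two c (TL_clusters hT c hc)
      exact ⟨hms c, g i, i, hi, hb, rfl⟩
    · exact ⟨(P_mono hk').trans E.P_n.subset, g 0, 0, by omega, rfl⟩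
  · exact Or.inr (Or.inr ⟨n, h5, le_rfl, E.P_n.symm⟩)
  · intro x hx
    exact Or.inl ⟨x, hx, rfl⟩
  · rintro A hA B hB
    rcases hA with ⟨x, hx, rfl⟩ | ⟨c, hc, rfl⟩ | ⟨k, hk, hk', rfl⟩
    · exact compat_single _ _
    · rcases hB with ⟨x, hx, rfl⟩ | ⟨d, hd, rfl⟩ | ⟨k, hk, hk', rfl⟩
      · exact compat_symm (compat_single _ _)
      · have := TL_cmp hT c hc d hd
        simp only [cmp, Bool.or_eq_true, beq_iff_eq] at this
        rw [← E.ms_and]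
        rcases this with (h | h) | h
        · left; rw [h, ms_zero]
        · right; left; rw [h]
        · right; right; rw [h]
      · exact compat_sub ((ms_P c).trans (P_mono hk))
    · rcases hB with ⟨x, hx, rfl⟩ | ⟨d, hd, rfl⟩ | ⟨l, hl, hl', rfl⟩
      · exact compat_symm (compat_single _ _)
      · exact compat_symm (compat_sub ((ms_P d).trans (P_mono hk)))
      · rcases le_total k l with h | h
        · exact compat_sub (P_mono h)
        · exact compat_symm (compat_sub (P_mono h))
  · intro k hk hk'
    exact Or.inr (Or.inr ⟨k, hk, hk', rfl⟩)

theorem mem_enc {T : Set (Set α)} {c : ℕ} : c ∈ enc g T ↔ c ∈ clusters ∧ ms g c ∈ T := by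
  simp [enc]

theorem enc_TL (E : En X g n) {T : Set (Set α)} (hT : T ∈ RP X) : enc g T ∈ TL := by
  classical
  apply filter_mem_enum
  intro a ha b hb h1 h2
  have la := clusters_lt a ha
  have lb := clusters_lt b hb
  have lab : a &&& b ≤ a := Nat.and_le_left
  have := hT.2.2.2 _ (of_decide_eq_true h1) _ (of_decide_eq_true h2)
  rw [← E.ms_and] at this
  simp only [cmp, Bool.or_eq_true, beq_iff_eq]
  rcases this with h | h | h
  · rw [← ms_zero (g := g)] at h
    exact Or.inl (Or.inl (E.ms_inj (by omega) (by omega) h))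
  · exact Or.inl (Or.inr (E.ms_inj (by omega) (by omega) h))
  · exact Or.inr (E.ms_inj (by omega) (by omega) h)

theorem exists_mask (E : En X g n) {C : Set α} (hC : C ⊆ P g 5) : ∃ c < 32, C = ms g c := by
  classical
  refine ⟨Nat.ofBits fun i : Fin 5 => decide (g i ∈ C), Nat.ofBits_lt_two_pow _, ?_⟩
  ext x
  constructor
  · intro hx
    obtain ⟨i, hi, rfl⟩ := hC hx
    exact ⟨i, hi, by rw [Nat.testBit_ofBits_lt _ _ hi]; simpa using hx, rfl⟩
  · rintro ⟨i, hi, hb, rfl⟩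
    rw [Nat.testBit_ofBits_lt _ _ hi] at hb
    simpa using hb

theorem dec_enc (E : En X g n) {T : Set (Set α)} (hT : Fam X g n T) :
    dec X g n (enc g T) = T := by
  classical
  have h5 := E.five
  ext C
  constructor
  · rintro (⟨x, hx, rfl⟩ | ⟨c, hc, rfl⟩ | ⟨k, hk, hk', rfl⟩)
    · exact hT.rp.2.2.1 x hx
    · exact (mem_enc.1 hc).2
    · exact hT.out k hk hk'
  · intro hC
    obtain ⟨hCX, hCne⟩ := hT.rp.1 C hC
    have hex : ∃ k, 5 ≤ k ∧ C ⊆ P g k := ⟨n, h5, hCX.trans E.P_n.symm.subset⟩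
    obtain ⟨hk5, hCk⟩ := Nat.find_spec hex
    have hkn : Nat.find hex ≤ n := Nat.find_min' hex ⟨h5, hCX.trans E.P_n.symm.subset⟩
    have hmin := fun k (h : k < Nat.find hex) => Nat.find_min hex h
    generalize Nat.find hex = k at hk5 hCk hkn hmin
    rcases Nat.eq_or_lt_of_le hk5 with rfl | hk
    · obtain ⟨c, hc, rfl⟩ := E.exists_mask hCk
      rcases mask_cases c hc with h | rfl | rfl | ⟨i, hi, rfl⟩
      · exact Or.inr (Or.inl ⟨c, mem_enc.2 ⟨h, hC⟩, rfl⟩)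
      · rw [ms_zero] at hCne; simp at hCne
      · refine Or.inr (Or.inr ⟨5, le_rfl, h5, (ms_P 31).antisymm ?_⟩)
        rintro x ⟨i, hi, rfl⟩
        exact ⟨i, hi, by interval_cases i <;> rfl, rfl⟩
      · refine Or.inl ⟨g i, E.gX (by omega), ?_⟩
        ext x
        constructor
        · rintro ⟨j, hj, hb, rfl⟩
          rw [Nat.testBit_two_pow, decide_eq_true_iff] at hb
          rw [hb]; rfl
        · rintro rfl
          exact ⟨i, hi, by simp [Nat.testBit_two_pow], rfl⟩
    · obtain ⟨k, rfl⟩ : ∃ l, k = l + 1 := ⟨k - 1, by omega⟩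
      have hnot : ¬ C ⊆ P g k := fun h => hmin k (by omega) ⟨by omega, h⟩
      have hgk : ∀ x ∈ C, x ∉ P g k → x = g k := by
        intro x hx hn
        obtain ⟨i, hi, rfl⟩ := hCk hx
        rcases Nat.lt_or_ge i k with h | h
        · exact absurd ⟨i, h, rfl⟩ hn
        · rw [show i = k by omega]
      obtain ⟨x, hx, hxn⟩ := not_subset.1 hnot
      have hkC : g k ∈ C := by rw [← hgk x hx hxn]; exact hx
      rcases hT.rp.2.2.2 C hC _ (hT.out k (by omega) (by omega)) with h | h | h
      · refine Or.inl ⟨g k, E.gX (by omega), ?_⟩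
        ext y
        constructor
        · intro hy
          refine hgk y hy fun hyP => ?_
          have : y ∈ C ∩ P g k := ⟨hy, hyP⟩
          rw [h] at this
          exact this
        · rintro rfl
          exact hkC
      · exact absurd (inter_eq_left.1 h) hnot
      · refine Or.inr (Or.inr ⟨k + 1, by omega, hkn, hCk.antisymm ?_⟩)
        rintro y ⟨i, hi, rfl⟩
        rcases Nat.lt_or_ge i k with h' | h'
        · exact inter_eq_right.1 h ⟨i, h', rfl⟩
        · rw [show i = k by omega]; exact hkC

theorem enc_dec (E : En X g n) {T : List ℕ} (hT : T ∈ TL) : enc g (dec X g n T) = T := by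
  classical
  have h5 := E.five
  have h1 := TL_isT T hT
  simp only [isT, Bool.and_eq_true, beq_iff_eq] at h1
  conv_rhs => rw [← h1.1]
  apply List.filter_congr
  intro c hc
  rw [Bool.eq_iff_iff, decide_eq_true_iff, List.contains_iff_mem]
  constructor
  · rintro (⟨x, hx, h⟩ | ⟨d, hd, h⟩ | ⟨k, hk, hk', h⟩)
    · exfalso
      obtain ⟨i, hi, j, hj, hij, hbi, hbj⟩ := clusters_two c hc
      have e1 : g i ∈ ms g c := ⟨i, hi, hbi, rfl⟩
      have e2 : g j ∈ ms g c := ⟨j, hj, hbj, rfl⟩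
      rw [h] at e1 e2
      exact hij (E.inj i (by omega) j (by omega) (e1.trans e2.symm))
    · have l1 := clusters_lt c hc
      have l2 := clusters_lt d (TL_clusters hT d hd)
      rwa [E.ms_inj (by omega) (by omega) h]
    · exfalso
      obtain ⟨i, hi, hb⟩ := clusters_miss c hc
      have : g i ∈ P g k := ⟨i, by omega, rfl⟩
      rw [← h, E.g_ms (by omega), hb] at this
      simp at this
  · intro h
    exact Or.inr (Or.inl ⟨c, h, rfl⟩)

theorem m_fam (E : En X g n) (hX : X.Finite) {m} (O : Op X m) {S T : Set (Set α)}
    (hS : Fam X g n S) (hT : Fam X g n T) : Fam X g n (m S T) := by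
  have hm := O.closed S hS.rp T hT.rp
  refine ⟨hm, fun k hk hk' => ?_⟩
  have hPX : P g k ⊆ X := (P_mono hk').trans E.P_n.subset
  refine sep_mem hX hm hPX ⟨g 0, 0, by omega, rfl⟩ ?_
  intro y hy y' hy' z hz hzP
  have e1 : y ≠ z := fun h => hzP (h ▸ hy)
  have e2 : y' ≠ z := fun h => hzP (h ▸ hy')
  by_cases h : y = y'
  · subst h
    exact ⟨{y}, hm.2.2.1 y (hPX hy), rfl, rfl, fun h => e1 h.symm⟩
  · exact O.pareto S hS.rp T hT.rp y (hPX hy) y' (hPX hy') z hz h e1 e2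
      ⟨_, hS.out k hk hk', hy, hy', hzP⟩ ⟨_, hT.out k hk hk', hy, hy', hzP⟩

end En

open Classical in
/-- The transposition of two leaves. -/
noncomputable def sg {α : Type*} (g : ℕ → α) (i j : ℕ) : Equiv.Perm α := Equiv.swap (g i) (g j)

namespace En

variable {X : Set α} {g : ℕ → α} {n : ℕ}

theorem sg_g (E : En X g n) {i j l : ℕ} (hi : i < 5) (hj : j < 5) (hl : l < n) :
    sg g i j (g l) = g (swn i j l) := by
  classical
  have h5 := E.five
  unfold sg swn
  split_ifs with h1 h2
  · rw [h1, Equiv.swap_apply_left]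
  · rw [h2, Equiv.swap_apply_right]
  · exact Equiv.swap_apply_of_ne_of_ne (fun h => h1 (E.inj _ hl _ (by omega) h))
      (fun h => h2 (E.inj _ hl _ (by omega) h))

theorem sg_sg (i j : ℕ) (x : α) : sg g i j (sg g i j x) = x := by
  classical
  exact Equiv.swap_apply_self _ _ _

theorem swn_lt {i j l k : ℕ} (hi : i < 5) (hj : j < 5) (hl : l < k) (hk : 5 ≤ k) :
    swn i j l < k := by
  unfold swn; split_ifs <;> omega

theorem sg_im (i j : ℕ) (C : Set α) (x : α) : x ∈ sg g i j '' C ↔ sg g i j x ∈ C := by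
  constructor
  · rintro ⟨y, hy, rfl⟩
    rwa [sg_sg]
  · intro h
    exact ⟨_, h, sg_sg i j x⟩

theorem sg_im_im (i j : ℕ) (C : Set α) : sg g i j '' (sg g i j '' C) = C := by
  ext x; rw [sg_im, sg_im, sg_sg]

theorem mem_map (i j : ℕ) (T : Set (Set α)) (C : Set α) :
    C ∈ mapTree (sg g i j) T ↔ sg g i j '' C ∈ T := by
  constructor
  · rintro ⟨D, hD, rfl⟩
    rwa [sg_im_im]
  · intro h
    exact ⟨_, h, sg_im_im i j C⟩

theorem sg_P (E : En X g n) {i j k : ℕ} (hi : i < 5) (hj : j < 5) (hk : 5 ≤ k) (hk' : k ≤ n) :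
    sg g i j '' P g k = P g k := by
  have key : ∀ x ∈ P g k, sg g i j x ∈ P g k := by
    rintro x ⟨l, hl, rfl⟩
    rw [E.sg_g hi hj (by omega)]
    exact ⟨_, swn_lt hi hj hl hk, rfl⟩
  ext x
  rw [sg_im]
  constructor
  · intro h
    have := key _ h
    rwa [sg_sg] at this
  · exact key x

theorem sg_ms (E : En X g n) {i j c : ℕ} (hi : i < 5) (hj : j < 5) (hc : c < 32) :
    sg g i j '' ms g c = ms g (sw i j c) := by
  have h5 := E.five
  ext x
  rw [sg_im]
  constructor
  · rintro ⟨l, hl, hb, he⟩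
    have e2 : x = g (swn i j l) := by
      rw [← E.sg_g hi hj (by omega), he, sg_sg]
    have hl' := swn_lt (k := 5) hi hj hl le_rfl
    refine ⟨_, hl', ?_, e2.symm⟩
    rw [sw_bit i hi j hj c hc _ hl']
    have : swn i j (swn i j l) = l := by
      unfold swn; split_ifs <;> omega
    rwa [this]
  · rintro ⟨l, hl, hb, rfl⟩
    rw [sw_bit i hi j hj c hc l hl] at hb
    rw [E.sg_g hi hj (by omega)]
    exact ⟨_, swn_lt hi hj hl le_rfl, hb, rfl⟩

theorem sg_bij (E : En X g n) {i j : ℕ} (hi : i < 5) (hj : j < 5) :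
    Set.BijOn (sg g i j) X X := by
  have := E.sg_P hi hj E.five le_rfl
  rw [E.P_n] at this
  refine ⟨fun x hx => ?_, (sg g i j).injective.injOn, this.symm.subset⟩
  rw [← this]
  exact ⟨x, hx, rfl⟩

theorem map_fam (E : En X g n) {i j : ℕ} (hi : i < 5) (hj : j < 5) {T : Set (Set α)}
    (hT : Fam X g n T) : Fam X g n (mapTree (sg g i j) T) := by
  have hX := E.sg_P hi hj E.five le_rfl
  rw [E.P_n] at hX
  refine ⟨⟨?_, ?_, ?_, ?_⟩, ?_⟩
  · rintro C ⟨D, hD, rfl⟩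
    obtain ⟨h1, h2⟩ := hT.rp.1 D hD
    refine ⟨?_, h2.image _⟩
    rw [← hX]
    exact image_mono h1
  · rw [mem_map, hX]; exact hT.rp.2.1
  · intro x hx
    rw [mem_map, image_singleton]
    exact hT.rp.2.2.1 _ ((E.sg_bij hi hj).1 hx)
  · rintro _ ⟨A, hA, rfl⟩ _ ⟨B, hB, rfl⟩
    rw [← image_inter (sg g i j).injective]
    rcases hT.rp.2.2.2 A hA B hB with h | h | h <;> rw [h] <;> simp
  · intro k hk hk'
    rw [mem_map, E.sg_P hi hj hk hk']
    exact hT.out k hk hk'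

theorem enc_map (E : En X g n) {i j : ℕ} (hi : i < 5) (hj : j < 5) (T : Set (Set α)) :
    enc g (mapTree (sg g i j) T) = act1 i j (enc g T) := by
  classical
  apply List.filter_congr
  intro c hc
  have hl := clusters_lt c hc
  rw [Bool.eq_iff_iff, decide_eq_true_iff, List.contains_iff_mem, mem_map,
    E.sg_ms hi hj (by omega), mem_enc]
  exact ⟨fun h => ⟨sw_clusters i hi j hj c hc, h⟩, fun h => h.2⟩

theorem dec_act (E : En X g n) {i j : ℕ} (hi : i < 5) (hj : j < 5) {S : List ℕ} (hS : S ∈ TL) :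
    dec X g n (act1 i j S) = mapTree (sg g i j) (dec X g n S) := by
  have h := E.enc_map hi hj (dec X g n S)
  rw [E.enc_dec hS] at h
  rw [← h, E.dec_enc (E.map_fam hi hj (E.dec_fam hS))]

theorem trip_iff (E : En X g n) {S : List ℕ} {a b c : ℕ} (ha : a < 5) (hb : b < 5)
    (hc : c < 5) (hab : a ≠ b) :
    trip S a b c = true ↔ sep (dec X g n S) (g a) (g b) (g c) := by
  have h5 := E.five
  simp only [trip, List.any_eq_true, Bool.and_eq_true, Bool.not_eq_true']
  constructor
  · rintro ⟨C, hC, ⟨h1, h2⟩, h3⟩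
    refine ⟨ms g C, Or.inr (Or.inl ⟨C, hC, rfl⟩), ⟨a, ha, h1, rfl⟩, ⟨b, hb, h2, rfl⟩, ?_⟩
    rw [E.g_ms (by omega), h3]
    simp
  · rintro ⟨C, (⟨x, hx, rfl⟩ | ⟨d, hd, rfl⟩ | ⟨k, hk, hk', rfl⟩), h1, h2, h3⟩
    · exact absurd (E.inj a (by omega) b (by omega) (h1.trans h2.symm)) hab
    · rw [E.g_ms (by omega)] at h1 h2 h3
      exact ⟨d, hd, ⟨h1.2, h2.2⟩, by simpa [hc] using h3⟩
    · exact absurd ⟨c, by omega, rfl⟩ h3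

theorem ax (E : En X g n) (hX : X.Finite) {m} (O : Op X m) :
    Ax (fun S T => enc g (m (dec X g n S) (dec X g n T))) := by
  have h5 := E.five
  have F := fun {S} (h : S ∈ TL) => E.dec_fam h
  have hde : ∀ S ∈ TL, ∀ T ∈ TL, dec X g n (enc g (m (dec X g n S) (dec X g n T))) =
      m (dec X g n S) (dec X g n T) := fun S hS T hT => E.dec_enc (E.m_fam hX O (F hS) (F hT))
  refine ⟨?_, ?_, ?_, ?_, ?_, ?_, ?_⟩
  · intro S hS T hT
    exact E.enc_TL (O.closed _ (F hS).rp _ (F hT).rp)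
  · intro T hT
    change enc g _ = T
    rw [O.idem _ (F hT).rp, E.enc_dec hT]
  · intro S hS T hT
    change enc g _ = enc g _
    rw [O.comm _ (F hS).rp _ (F hT).rp]
  · intro S hS T hT U hU
    change enc g (m (dec X g n (enc g _)) _) = enc g (m _ (dec X g n (enc g _)))
    rw [hde S hS T hT, hde T hT U hU, O.assoc _ (F hS).rp _ (F hT).rp _ (F hU).rp]
  · intro i hi j hj S hS T hT
    change enc g _ = act1 i j (enc g _)
    rw [E.dec_act hi hj hS, E.dec_act hi hj hT, O.equi _ (E.sg_bij hi hj) _ (F hS).rp _ (F hT).rp,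
      E.enc_map hi hj]
  · intro i hi j hj T hT
    have h := E.enc_map hi hj (dec X g n T)
    rw [E.enc_dec hT] at h
    rw [← h]
    exact E.enc_TL (E.map_fam hi hj (F hT)).rp
  · intro S hS T hT a ha b hb c hc hab hac hbc h1 h2
    rw [E.trip_iff ha hb hc hab] at h1 h2 ⊢
    rw [hde S hS T hT]
    exact O.pareto _ (F hS).rp _ (F hT).rp _ (E.gX (by omega)) _ (E.gX (by omega)) _
      (E.gX (by omega)) (fun h => hab (E.inj a (by omega) b (by omega) h))
      (fun h => hac (E.inj a (by omega) c (by omega) h))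
      (fun h => hbc (E.inj b (by omega) c (by omega) h)) h1 h2

end En

end Code

/-- For any finite taxon set `X` with at least 5 elements, there is no
consensus method on `X` (a family `φ k : RP(X)^k → RP(X)`, `k ≥ 1`) that is regular,
associatively stable, and Pareto on rooted triples. -/
theorem no_regular_assoc_stable_pareto_consensus_method
    (X : Set α) (hXfin : X.Finite) (hX5 : 5 ≤ X.ncard) :
    ¬ ∃ φ : (k : ℕ) → (Fin k → Set (Set α)) → Set (Set α),
      IsRegularAssocStablePareto X φ := by
  rintro ⟨φ, hφ⟩
  obtain ⟨g, E⟩ := Code.exists_En X hXfin hX5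
  exact (E.ax hXfin (Code.op_of hφ)).contra
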